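/- The map σ : ℂ³ → ℂ³ defined by σ(z₁,z₂,z₃) = (i·z₁, i·z₂, −z₃) is a group automorphism of the complex Heisenberg group (ℂ³, ⋆), it maps the subgroup Γ = (ℤ[i])³ bijectively onto itself, and it has order exactly 4 (σ⁴ = id but σ² ≠ id). -/

import Mathlib

/-- The complex Heisenberg group operation on ℂ³. -/
def heisMul (z w : ℂ × ℂ × ℂ) : ℂ × ℂ × ℂ :=
  (z.1 + w.1, z.2.1 + w.2.1, z.2.2 + z.1 * w.2.1 + w.2.2)

/-- The Gaussian integers, viewed as a subset of ℂ. -/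
def GInt : Set ℂ := {z | ∃ a b : ℤ, z = (a : ℂ) + (b : ℂ) * Complex.I}

/-- The lattice Γ = (ℤ[i])³ ⊆ ℂ³. -/
def GammaSet : Set (ℂ × ℂ × ℂ) := {γ | γ.1 ∈ GInt ∧ γ.2.1 ∈ GInt ∧ γ.2.2 ∈ GInt}

/-- The map σ(z₁,z₂,z₃) = (i z₁, i z₂, −z₃). -/
def sigmaMap (z : ℂ × ℂ × ℂ) : ℂ × ℂ × ℂ :=
  (Complex.I * z.1, Complex.I * z.2.1, -z.2.2)

theorem GInt_I_mul {z : ℂ} (hz : z ∈ GInt) : Complex.I * z ∈ GInt := by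
  obtain ⟨a, b, rfl⟩ := hz
  refine ⟨-b, a, ?_⟩
  push_cast
  linear_combination (b : ℂ) * Complex.I_mul_I

theorem GInt_neg {z : ℂ} (hz : z ∈ GInt) : -z ∈ GInt := by
  obtain ⟨a, b, rfl⟩ := hz
  refine ⟨-a, -b, ?_⟩
  push_cast
  ring

theorem sigmaMap_mem {z : ℂ × ℂ × ℂ} (hz : z ∈ GammaSet) : sigmaMap z ∈ GammaSet :=
  ⟨GInt_I_mul hz.1, GInt_I_mul hz.2.1, GInt_neg hz.2.2⟩

theorem I_mul_four (x : ℂ) :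
    Complex.I * (Complex.I * (Complex.I * (Complex.I * x))) = x := by
  linear_combination (x * Complex.I * Complex.I - x) * Complex.I_mul_I

theorem sigmaMap_four (z : ℂ × ℂ × ℂ) :
    sigmaMap (sigmaMap (sigmaMap (sigmaMap z))) = z := by
  obtain ⟨a, b, c⟩ := z
  simp only [sigmaMap, I_mul_four, neg_neg]

theorem sigma_automorphism_order_four :
    (∀ z w : ℂ × ℂ × ℂ, sigmaMap (heisMul z w) = heisMul (sigmaMap z) (sigmaMap w)) ∧
    Function.Bijective sigmaMap ∧
    sigmaMap '' GammaSet = GammaSet ∧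
    (sigmaMap ∘ sigmaMap ∘ sigmaMap ∘ sigmaMap = id) ∧
    (sigmaMap ∘ sigmaMap ≠ id) := by
  refine ⟨?_, ⟨?_, ?_⟩, ?_, ?_, ?_⟩
  · intro z w
    simp only [sigmaMap, heisMul, Prod.mk.injEq]
    refine ⟨by ring, by ring, ?_⟩
    linear_combination (-(z.1 * w.2.1)) * Complex.I_mul_I
  · intro z w h
    rw [← sigmaMap_four z, h, sigmaMap_four]
  · intro z
    exact ⟨_, sigmaMap_four z⟩
  · apply Set.Subset.antisymm
    · rintro _ ⟨z, hz, rfl⟩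
      exact sigmaMap_mem hz
    · intro z hz
      exact ⟨_, sigmaMap_mem (sigmaMap_mem (sigmaMap_mem hz)), sigmaMap_four z⟩
  · funext z
    exact sigmaMap_four z
  · intro h
    have h1 := congrArg Prod.fst (congrFun h (1, 0, 0))
    simp only [sigmaMap, Function.comp, id, mul_one, Complex.I_mul_I] at h1
    norm_num at h1
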